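/- Let k be a field of characteristic 2 and n ≥ 1. Let A = k[S,T]/(S², T^{2^n}), and let Δ₁, Δ₂ be two bialgebra structures on A (over k) with, in both, Δ(S̄) = S̄⊗1 + 1⊗S̄ and counit sending S̄, T̄ to 0, and with Δ₁(T̄) = T̄⊗1 + 1⊗T̄ + S̄⊗T̄² and Δ₂(T̄) = T̄⊗1 + 1⊗T̄ + T̄²⊗S̄. Then the k-algebra endomorphism φ of A determined by φ(S̄) = S̄ and φ(T̄) = T̄ + S̄·T̄² is bijective and is a bialgebra isomorphism from (A, Δ₁) to (A, Δ₂), i.e. Δ₂(φ(x)) = (φ⊗φ)(Δ₁(x)) for all x and φ commutes with the counits. -/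

import Mathlib

open scoped TensorProduct

/-- `(Δ, ε)` is a bialgebra structure on the `k`-algebra `A`: the comultiplication `Δ` and
counit `ε` are `k`-algebra homomorphisms, `Δ` is coassociative and `ε` is a counit for `Δ`. -/
def IsBialgebraStructure (k A : Type*) [CommRing k] [CommRing A] [Algebra k A]
    (Δ : A →ₐ[k] A ⊗[k] A) (ε : A →ₐ[k] k) : Prop :=
  (∀ x : A, (TensorProduct.assoc k A A A)
      ((TensorProduct.map Δ.toLinearMap (LinearMap.id : A →ₗ[k] A)) (Δ x))
      = (TensorProduct.map (LinearMap.id : A →ₗ[k] A) Δ.toLinearMap) (Δ x)) ∧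
  (∀ x : A, (TensorProduct.lid k A)
      ((TensorProduct.map ε.toLinearMap (LinearMap.id : A →ₗ[k] A)) (Δ x)) = x) ∧
  (∀ x : A, (TensorProduct.rid k A)
      ((TensorProduct.map (LinearMap.id : A →ₗ[k] A) ε.toLinearMap) (Δ x)) = x)

/-- The truncated polynomial ring `k[S,T]/(S^M, T^N)`, with `S = X 0` and `T = X 1`. -/
abbrev TruncPoly₂ (k : Type*) [CommRing k] (M N : ℕ) : Type _ :=
  MvPolynomial (Fin 2) k ⧸
    Ideal.span {(MvPolynomial.X 0 : MvPolynomial (Fin 2) k) ^ M, (MvPolynomial.X 1) ^ N}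

/-- The class of `S` in `k[S,T]/(S^M, T^N)`. -/
noncomputable abbrev truncS₂ (k : Type*) [CommRing k] (M N : ℕ) : TruncPoly₂ k M N :=
  Ideal.Quotient.mk _ (MvPolynomial.X 0)

/-- The class of `T` in `k[S,T]/(S^M, T^N)`. -/
noncomputable abbrev truncT₂ (k : Type*) [CommRing k] (M N : ℕ) : TruncPoly₂ k M N :=
  Ideal.Quotient.mk _ (MvPolynomial.X 1)

/-- Two algebra homomorphisms out of `k[S,T]/(S^M, T^N)` agreeing on `S̄` and `T̄` are equal. -/
theorem TruncPoly₂.algHom_ext {k : Type*} [CommRing k] {M N : ℕ} {B : Type*} [Semiring B]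
    [Algebra k B] {f g : TruncPoly₂ k M N →ₐ[k] B}
    (hS : f (truncS₂ k M N) = g (truncS₂ k M N))
    (hT : f (truncT₂ k M N) = g (truncT₂ k M N)) : f = g := by
  refine Ideal.Quotient.algHom_ext k (MvPolynomial.algHom_ext fun i ↦ ?_)
  fin_cases i
  · exact hS
  · exact hT

theorem truncS₂_pow (k : Type*) [CommRing k] (M N : ℕ) : truncS₂ k M N ^ M = 0 := by
  rw [truncS₂, ← map_pow]
  exact Ideal.Quotient.eq_zero_iff_mem.2 (Ideal.subset_span (by simp))

/-- In characteristic two, if `Δ s = s⊗1 + 1⊗s` with `s² = 0`, and `Δ t = t⊗1 + 1⊗t + t²⊗s`,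
then `t' = t + s t²` satisfies `Δ t' = t'⊗1 + 1⊗t' + s⊗t'²`. -/
theorem comul_add_mul_sq {k A : Type*} [CommRing k] [CommRing A] [Algebra k A] [CharP A 2]
    (Δ : A →ₐ[k] A ⊗[k] A) {s t : A} (hs : s ^ 2 = 0)
    (hΔs : Δ s = s ⊗ₜ[k] (1 : A) + (1 : A) ⊗ₜ[k] s)
    (hΔt : Δ t = t ⊗ₜ[k] (1 : A) + (1 : A) ⊗ₜ[k] t + (t ^ 2) ⊗ₜ[k] s) :
    Δ (t + s * t ^ 2) = (t + s * t ^ 2) ⊗ₜ[k] (1 : A) + (1 : A) ⊗ₜ[k] (t + s * t ^ 2) +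
      s ⊗ₜ[k] ((t + s * t ^ 2) ^ 2) := by
  have h2 : (2 : A ⊗[k] A) = 0 := by
    have h : (2 : A) = 0 := CharTwo.two_eq_zero
    rw [← map_ofNat (Algebra.TensorProduct.includeLeft : A →ₐ[k] A ⊗[k] A) 2, h, map_zero]
  have hφ : (t + s * t ^ 2) ^ 2 = t ^ 2 := by
    rw [CharTwo.add_sq, mul_pow, hs, zero_mul, add_zero]
  have hsplit (a b : A) : a ⊗ₜ[k] b = (a ⊗ₜ[k] (1 : A)) * ((1 : A) ⊗ₜ[k] b) := by simp
  have hl (a b : A) : (a * b) ⊗ₜ[k] (1 : A) = (a ⊗ₜ[k] (1 : A)) * (b ⊗ₜ[k] (1 : A)) := by simp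
  have hr (a b : A) : (1 : A) ⊗ₜ[k] (a * b) = ((1 : A) ⊗ₜ[k] a) * ((1 : A) ⊗ₜ[k] b) := by simp
  have hsr : ((1 : A) ⊗ₜ[k] s) ^ 2 = 0 := by simp [hs]
  have hsl : (s ⊗ₜ[k] (1 : A)) ^ 2 = 0 := by simp [hs]
  rw [map_add, map_mul, map_pow, hΔs, hΔt, hφ, hsplit (t ^ 2) s, hsplit s (t ^ 2),
    TensorProduct.add_tmul, TensorProduct.tmul_add]
  simp only [pow_two t, hl, hr]
  generalize s ⊗ₜ[k] (1 : A) = a at *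
  generalize (1 : A) ⊗ₜ[k] s = b at *
  generalize t ⊗ₜ[k] (1 : A) = c at *
  generalize (1 : A) ⊗ₜ[k] t = d at *
  grind

/-- Let `k` have characteristic `2`, `n ≥ 1`, and `A = k[S,T]/(S², T^{2^n})`.  Given the two
bialgebra structures `(Δ₁, ε₁)` and `(Δ₂, ε₂)` on `A` with `Δᵢ(S̄) = S̄⊗1 + 1⊗S̄`, counits
sending `S̄, T̄` to `0`, and `Δ₁(T̄) = T̄⊗1 + 1⊗T̄ + S̄⊗T̄²`,
`Δ₂(T̄) = T̄⊗1 + 1⊗T̄ + T̄²⊗S̄`, the `k`-algebra endomorphism `φ` of `A` with `φ(S̄) = S̄` and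
`φ(T̄) = T̄ + S̄·T̄²` is bijective and is a bialgebra isomorphism from `(A, Δ₁)` to
`(A, Δ₂)`. -/
theorem stmt_10 (k : Type*) [Field k] (hchar : CharP k 2) (n : ℕ) (hn : 1 ≤ n)
    (Δ₁ Δ₂ : TruncPoly₂ k 2 (2 ^ n) →ₐ[k] TruncPoly₂ k 2 (2 ^ n) ⊗[k] TruncPoly₂ k 2 (2 ^ n))
    (ε₁ ε₂ : TruncPoly₂ k 2 (2 ^ n) →ₐ[k] k)
    (hbi₁ : IsBialgebraStructure k (TruncPoly₂ k 2 (2 ^ n)) Δ₁ ε₁)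
    (hbi₂ : IsBialgebraStructure k (TruncPoly₂ k 2 (2 ^ n)) Δ₂ ε₂)
    (hε₁S : ε₁ (truncS₂ k 2 (2 ^ n)) = 0) (hε₁T : ε₁ (truncT₂ k 2 (2 ^ n)) = 0)
    (hε₂S : ε₂ (truncS₂ k 2 (2 ^ n)) = 0) (hε₂T : ε₂ (truncT₂ k 2 (2 ^ n)) = 0)
    (hΔ₁S : Δ₁ (truncS₂ k 2 (2 ^ n)) =
      truncS₂ k 2 (2 ^ n) ⊗ₜ[k] (1 : TruncPoly₂ k 2 (2 ^ n)) +
        (1 : TruncPoly₂ k 2 (2 ^ n)) ⊗ₜ[k] truncS₂ k 2 (2 ^ n))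
    (hΔ₂S : Δ₂ (truncS₂ k 2 (2 ^ n)) =
      truncS₂ k 2 (2 ^ n) ⊗ₜ[k] (1 : TruncPoly₂ k 2 (2 ^ n)) +
        (1 : TruncPoly₂ k 2 (2 ^ n)) ⊗ₜ[k] truncS₂ k 2 (2 ^ n))
    (hΔ₁T : Δ₁ (truncT₂ k 2 (2 ^ n)) =
      truncT₂ k 2 (2 ^ n) ⊗ₜ[k] (1 : TruncPoly₂ k 2 (2 ^ n)) +
        (1 : TruncPoly₂ k 2 (2 ^ n)) ⊗ₜ[k] truncT₂ k 2 (2 ^ n) +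
        truncS₂ k 2 (2 ^ n) ⊗ₜ[k] (truncT₂ k 2 (2 ^ n) ^ 2))
    (hΔ₂T : Δ₂ (truncT₂ k 2 (2 ^ n)) =
      truncT₂ k 2 (2 ^ n) ⊗ₜ[k] (1 : TruncPoly₂ k 2 (2 ^ n)) +
        (1 : TruncPoly₂ k 2 (2 ^ n)) ⊗ₜ[k] truncT₂ k 2 (2 ^ n) +
        (truncT₂ k 2 (2 ^ n) ^ 2) ⊗ₜ[k] truncS₂ k 2 (2 ^ n))
    (φ : TruncPoly₂ k 2 (2 ^ n) →ₐ[k] TruncPoly₂ k 2 (2 ^ n))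
    (hφS : φ (truncS₂ k 2 (2 ^ n)) = truncS₂ k 2 (2 ^ n))
    (hφT : φ (truncT₂ k 2 (2 ^ n)) =
      truncT₂ k 2 (2 ^ n) + truncS₂ k 2 (2 ^ n) * truncT₂ k 2 (2 ^ n) ^ 2) :
    Function.Bijective φ ∧
    (∀ x, Δ₂ (φ x) = (Algebra.TensorProduct.map φ φ) (Δ₁ x)) ∧
    (∀ x, ε₂ (φ x) = ε₁ x) := by
  have hs : truncS₂ k 2 (2 ^ n) ^ 2 = 0 := truncS₂_pow k 2 (2 ^ n)
  have : Nontrivial (TruncPoly₂ k 2 (2 ^ n)) := RingHom.domain_nontrivial (ε₁ : _ →+* k)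
  have : CharP (TruncPoly₂ k 2 (2 ^ n)) 2 :=
    charP_of_injective_algebraMap (algebraMap k (TruncPoly₂ k 2 (2 ^ n))).injective 2
  have hinv : φ.comp φ = AlgHom.id k (TruncPoly₂ k 2 (2 ^ n)) := by
    apply TruncPoly₂.algHom_ext
    · simp only [AlgHom.comp_apply, AlgHom.id_apply, hφS]
    · simp only [AlgHom.comp_apply, AlgHom.id_apply, hφT, hφS, map_add, map_mul, map_pow]
      rw [CharTwo.add_sq, mul_pow, hs, zero_mul, add_zero, add_assoc, CharTwo.add_self_eq_zero,
        add_zero]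
  have hcomul : Δ₂.comp φ = (Algebra.TensorProduct.map φ φ).comp Δ₁ := by
    apply TruncPoly₂.algHom_ext
    · simp only [AlgHom.comp_apply, hφS, hΔ₁S, hΔ₂S, map_add, map_one,
        Algebra.TensorProduct.map_tmul]
    · rw [AlgHom.comp_apply, AlgHom.comp_apply, hφT, comul_add_mul_sq Δ₂ hs hΔ₂S hΔ₂T, hΔ₁T]
      simp only [map_add, map_one, map_pow, Algebra.TensorProduct.map_tmul, hφS, hφT]
  have hcounit : ε₂.comp φ = ε₁ := by
    apply TruncPoly₂.algHom_ext
    · simp only [AlgHom.comp_apply, hφS, hε₁S, hε₂S]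
    · simp only [AlgHom.comp_apply, hφT, hε₁T, hε₂S, hε₂T, map_add, map_mul, zero_mul, add_zero]
  have hφφ : Function.Involutive φ := DFunLike.congr_fun hinv
  exact ⟨hφφ.bijective, DFunLike.congr_fun hcomul, DFunLike.congr_fun hcounit⟩
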